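/- Let (J,·) be a (2n+1)-dimensional Jacobi–Jordan algebra, α a linear form and ω an alternating bilinear form on J. On the direct sum JJ-algebra J ⊕ Ke (product extending that of J, with all products involving e equal to 0) define the alternating bilinear form Ω = ω + α ∧ e*, i.e. Ω(x,y) = ω(x,y), Ω(x,e) = α(x) for x, y ∈ J. Then (J, α, ω) is a cosymplectic JJ-algebra if and only if (J ⊕ Ke, Ω) is a symplectic JJ-algebra. -/

import Mathlib

/-- Evaluation of the wedge product `α ∧ ωⁿ` of a 1-form `α` and a 2-form `ω` on a tuple of
`2n+1` vectors, via the normalized (characteristic-free, "shuffle/matching") formula: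
the sum ranges over canonical representatives of the decompositions of `{0,…,2n}` into a
singleton (fed to `α`) and `n` ordered pairs (fed to `ω`).  `α ∧ ωⁿ ≠ 0` is rendered as
`∃ v, wedgeEval K n α ω v ≠ 0`. -/
def wedgeEval (K : Type*) [Field K] {V : Type*} (n : ℕ)
    (α : V → K) (ω : V → V → K) (v : Fin (2*n+1) → V) : K :=
  ∑ σ ∈ Finset.filter
      (fun σ : Equiv.Perm (Fin (2*n+1)) =>
        (∀ i : Fin n, σ ⟨2*(i:ℕ)+1, by have := i.2; omega⟩ < σ ⟨2*(i:ℕ)+2, by have := i.2; omega⟩) ∧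
        (∀ i j : Fin n, i < j →
          σ ⟨2*(i:ℕ)+1, by have := i.2; omega⟩ < σ ⟨2*(j:ℕ)+1, by have := j.2; omega⟩))
      Finset.univ,
    (Equiv.Perm.sign σ : ℤ) •
      (α (v (σ ⟨0, by omega⟩)) *
        ∏ i : Fin n,
          ω (v (σ ⟨2*(i:ℕ)+1, by have := i.2; omega⟩)) (v (σ ⟨2*(i:ℕ)+2, by have := i.2; omega⟩)))

namespace WedgeEval

open Equiv Finset

/-- The index `2i+1` or `2i+2`: the first or second entry of the `i`-th pair. -/
def pos {n : ℕ} (i : Fin n) : Bool → Fin (2*n+1)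
  | false => ⟨2*(i:ℕ)+1, by have := i.2; omega⟩
  | true => ⟨2*(i:ℕ)+2, by have := i.2; omega⟩

/-- The index fed to the linear form. -/
def root (n : ℕ) : Fin (2*n+1) := ⟨0, by omega⟩

/-- Decomposition of the indices into the root and the entries of the pairs. -/
noncomputable def idx (n : ℕ) : Option (Fin n × Bool) ≃ Fin (2*n+1) :=
  Equiv.ofBijective (fun o => o.elim (root n) fun p => pos p.1 p.2) <| by
    rw [Fintype.bijective_iff_injective_and_card]
    refine ⟨?_, by simp; omega⟩
    rintro (_ | ⟨i, _ | _⟩) (_ | ⟨j, _ | _⟩) h <;>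
      simp [pos, root, Fin.ext_iff] at h ⊢ <;> omega

@[simp] lemma idx_none (n : ℕ) : idx n none = root n := rfl

@[simp] lemma idx_some {n : ℕ} (i : Fin n) (c : Bool) : idx n (some (i, c)) = pos i c := rfl

lemma pos_inj {n : ℕ} {i j : Fin n} {b c : Bool} : pos i b = pos j c ↔ i = j ∧ b = c := by
  rw [← idx_some, ← idx_some, (idx n).apply_eq_iff_eq]
  simp

lemma pos_ne_root {n : ℕ} (i : Fin n) (c : Bool) : pos i c ≠ root n := by
  rw [← idx_some, ← idx_none, Ne, (idx n).apply_eq_iff_eq]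
  simp

lemma eq_root_or_pos {n : ℕ} (k : Fin (2*n+1)) : k = root n ∨ ∃ i c, k = pos i c := by
  obtain ⟨_ | ⟨i, c⟩, rfl⟩ := (idx n).surjective k
  · exact Or.inl rfl
  · exact Or.inr ⟨i, c, rfl⟩

/-- The canonical representatives of the decompositions into a singleton and `n` pairs. -/
def Canonical {n : ℕ} (σ : Perm (Fin (2*n+1))) : Prop :=
  (∀ i : Fin n, σ (pos i false) < σ (pos i true)) ∧
    ∀ i j : Fin n, i < j → σ (pos i false) < σ (pos j false)

/-- The permutations fixing the root and mapping pairs to pairs. -/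
def PairPreserving {n : ℕ} (h : Perm (Fin (2*n+1))) : Prop :=
  h (root n) = root n ∧ ∀ i, ∃ j b, ∀ c, h (pos i c) = pos j (xor b c)

lemma PairPreserving.mul {n : ℕ} {g h : Perm (Fin (2*n+1))} (hg : PairPreserving g)
    (hh : PairPreserving h) : PairPreserving (g * h) := by
  refine ⟨by simp [hg.1, hh.1], fun i => ?_⟩
  obtain ⟨j, b, hj⟩ := hh.2 i
  obtain ⟨k, c, hk⟩ := hg.2 j
  exact ⟨k, xor c b, fun d => by simp [hj, hk]⟩

lemma PairPreserving.eq_one {n : ℕ} {σ h : Perm (Fin (2*n+1))} (hh : PairPreserving h)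
    (hσ : Canonical σ) (hσh : Canonical (σ * h)) : h = 1 := by
  choose κ b hκ using hh.2
  have hb : ∀ i, b i = false := by
    intro i
    by_contra hbi
    rw [Bool.not_eq_false] at hbi
    have h1 := hσh.1 i
    simp only [Perm.mul_apply, hκ, hbi] at h1
    exact lt_asymm h1 (hσ.1 (κ i))
  have hmono : StrictMono κ := by
    intro i j hij
    have h1 := hσh.2 i j hij
    simp only [Perm.mul_apply, hκ, hb, Bool.false_xor] at h1
    by_contra hlt
    rcases (not_lt.mp hlt).eq_or_lt with h2 | h2
    · rw [h2] at h1
      exact lt_irrefl _ h1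
    · exact lt_asymm h1 (hσ.2 _ _ h2)
  have hid : κ = id := hmono.eq_id
  ext k : 1
  obtain rfl | ⟨i, c, rfl⟩ := eq_root_or_pos k
  · exact hh.1
  · simp [hκ, hb, hid]

/-- Extension of a permutation of the pair entries by fixing the root. -/
noncomputable def lift {n : ℕ} (g : Perm (Fin n × Bool)) : Perm (Fin (2*n+1)) :=
  (idx n).permCongr g.optionCongr

lemma sign_lift {n : ℕ} (g : Perm (Fin n × Bool)) : Perm.sign (lift g) = Perm.sign g := by
  simp [lift]

lemma lift_root {n : ℕ} (g : Perm (Fin n × Bool)) : lift g (root n) = root n := by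
  simp [lift, (idx n).symm_apply_eq.mpr (idx_none n).symm]

lemma lift_pos {n : ℕ} (g : Perm (Fin n × Bool)) (i : Fin n) (c : Bool) :
    lift g (pos i c) = pos (g (i, c)).1 (g (i, c)).2 := by
  simp [lift, ← idx_some]

/-- Exchange of the two entries of the pairs selected by `ε`. -/
noncomputable def flip {n : ℕ} (ε : Fin n → Bool) : Perm (Fin (2*n+1)) :=
  lift (prodCongrRight fun i => if ε i then Equiv.boolNot else 1)

lemma flip_root {n : ℕ} (ε : Fin n → Bool) : flip ε (root n) = root n := lift_root _

lemma flip_pos {n : ℕ} (ε : Fin n → Bool) (i : Fin n) (c : Bool) :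
    flip ε (pos i c) = pos i (xor (ε i) c) := by
  rw [flip, lift_pos]
  cases h : ε i <;> simp [h]

lemma sign_flip {n : ℕ} (ε : Fin n → Bool) :
    Perm.sign (flip ε) = ∏ i, if ε i then -1 else 1 := by
  rw [flip, sign_lift, Perm.sign_prodCongrRight]
  refine Finset.prod_congr rfl fun i _ => ?_
  split_ifs
  · decide
  · simp

/-- Permutation of the pairs. -/
noncomputable def block {n : ℕ} (π : Perm (Fin n)) : Perm (Fin (2*n+1)) :=
  lift (prodCongrLeft fun _ => π)

lemma block_root {n : ℕ} (π : Perm (Fin n)) : block π (root n) = root n := lift_root _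

lemma block_pos {n : ℕ} (π : Perm (Fin n)) (i : Fin n) (c : Bool) :
    block π (pos i c) = pos (π i) c := by
  rw [block, lift_pos]
  simp

lemma sign_block {n : ℕ} (π : Perm (Fin n)) : Perm.sign (block π) = 1 := by
  rw [block, sign_lift, Perm.sign_prodCongrLeft]
  simp

section Summand

variable {K V : Type*} [Field K]

/-- The summand of `wedgeEval` attached to a permutation. -/
def term {n : ℕ} (α : V → K) (ω : V → V → K) (v : Fin (2*n+1) → V)
    (σ : Perm (Fin (2*n+1))) : K :=
  (Perm.sign σ : ℤ) •
    (α (v (σ (root n))) * ∏ i : Fin n, ω (v (σ (pos i false))) (v (σ (pos i true))))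

open Classical in
lemma wedgeEval_eq (n : ℕ) (α : V → K) (ω : V → V → K) (v : Fin (2*n+1) → V) :
    wedgeEval K n α ω v = ∑ σ with Canonical σ, term α ω v σ := by
  unfold wedgeEval
  refine Finset.sum_congr ?_ fun _ _ => rfl
  ext σ
  simp only [Finset.mem_filter]
  rfl

lemma term_mul_block {n : ℕ} (α : V → K) (ω : V → V → K) (v : Fin (2*n+1) → V)
    (σ : Perm (Fin (2*n+1))) (π : Perm (Fin n)) :
    term α ω v (σ * block π) = term α ω v σ := by
  simp only [term, Perm.sign_mul, sign_block, Perm.mul_apply, block_root, block_pos, mul_one]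
  rw [Equiv.prod_comp π fun i => ω (v (σ (pos i false))) (v (σ (pos i true)))]

lemma term_mul_flip {n : ℕ} (α : V → K) (ω : V → V → K) (hω : ∀ x y, ω x y = -ω y x)
    (v : Fin (2*n+1) → V) (σ : Perm (Fin (2*n+1))) (ε : Fin n → Bool) :
    term α ω v (σ * flip ε) = term α ω v σ := by
  have key : ∏ i, ω (v (σ (pos i (xor (ε i) false)))) (v (σ (pos i (xor (ε i) true)))) =
      (∏ i, if ε i then (-1 : K) else 1) *
        ∏ i, ω (v (σ (pos i false))) (v (σ (pos i true))) := by
    rw [← Finset.prod_mul_distrib]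
    refine Finset.prod_congr rfl fun i _ => ?_
    cases ε i
    · simp
    · simpa using hω _ _
  have hs : ((∏ i, if ε i then (-1 : K) else 1) * ∏ i, if ε i then (-1 : K) else 1) = 1 := by
    rw [← Finset.prod_mul_distrib]
    exact Finset.prod_eq_one fun i _ => by split_ifs <;> simp
  have hc : (((∏ i, if ε i then (-1 : ℤˣ) else 1 : ℤˣ) : ℤ) : K) =
      ∏ i, if ε i then (-1 : K) else 1 := by
    rw [Units.coe_prod, Int.cast_prod]
    exact Finset.prod_congr rfl fun i _ => by split_ifs <;> simp
  simp only [term, Perm.sign_mul, sign_flip, Perm.mul_apply, flip_root, flip_pos, key,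
    Units.val_mul, zsmul_eq_mul, Int.cast_mul, hc]
  linear_combination ((Perm.sign σ : ℤ) : K) * α (v (σ (root n))) *
    (∏ i, ω (v (σ (pos i false))) (v (σ (pos i true)))) * hs

lemma exists_canonical {n : ℕ} (α : V → K) (ω : V → V → K) (hω : ∀ x y, ω x y = -ω y x)
    (σ : Perm (Fin (2*n+1))) :
    ∃ h, PairPreserving h ∧ Canonical (σ * h) ∧ ∀ v, term α ω v (σ * h) = term α ω v σ := by
  let ε : Fin n → Bool := fun i => decide (σ (pos i true) < σ (pos i false))
  let f : Fin n → Fin (2*n+1) := fun i => (σ * flip ε) (pos i false)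
  let π : Perm (Fin n) := Tuple.sort f
  refine ⟨flip ε * block π, PairPreserving.mul ?_ ?_, ⟨fun i => ?_, fun i j hij => ?_⟩,
    fun v => ?_⟩
  · exact ⟨flip_root ε, fun i => ⟨i, ε i, flip_pos ε i⟩⟩
  · exact ⟨block_root π, fun i => ⟨π i, false, fun c => by simp [block_pos]⟩⟩
  · simp only [Perm.mul_apply, block_pos, flip_pos]
    by_cases h : σ (pos (π i) true) < σ (pos (π i) false)
    · simp [ε, h]
    · have hne : σ (pos (π i) false) ≠ σ (pos (π i) true) :=
        σ.injective.ne (by simp [pos_inj])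
      simpa [ε, h] using lt_of_le_of_ne (not_lt.mp h) hne
  · have hle : f (π i) ≤ f (π j) := Tuple.monotone_sort f hij.le
    have hne : f (π i) ≠ f (π j) :=
      (σ * flip ε).injective.ne fun h => hij.ne (π.injective (pos_inj.mp h).1)
    simpa [f, block_pos] using lt_of_le_of_ne hle hne
  · rw [← mul_assoc, term_mul_block, term_mul_flip α ω hω]

lemma term_comp {n : ℕ} (α : V → K) (ω : V → V → K) (v : Fin (2*n+1) → V)
    (τ σ : Perm (Fin (2*n+1))) :
    term α ω v (τ * σ) = (Perm.sign τ : ℤ) • term α ω (v ∘ τ) σ := by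
  simp [term, mul_assoc]

lemma wedgeEval_comp {n : ℕ} (α : V → K) (ω : V → V → K) (hω : ∀ x y, ω x y = -ω y x)
    (v : Fin (2*n+1) → V) (τ : Perm (Fin (2*n+1))) :
    wedgeEval K n α ω v = (Perm.sign τ : ℤ) • wedgeEval K n α ω (v ∘ τ) := by
  classical
  choose c hc hcan hterm using exists_canonical (n := n) α ω hω
  have inv : ∀ ρ σ : Perm (Fin (2*n+1)), Canonical σ →
      ρ⁻¹ * (ρ * σ * c (ρ * σ)) * c (ρ⁻¹ * (ρ * σ * c (ρ * σ))) = σ := by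
    intro ρ σ hσ
    have h1 : ρ⁻¹ * (ρ * σ * c (ρ * σ)) = σ * c (ρ * σ) := by group
    have h2 := hcan (σ * c (ρ * σ))
    rw [h1]
    rw [mul_assoc] at h2 ⊢
    rw [((hc _).mul (hc _)).eq_one hσ h2, mul_one]
  rw [wedgeEval_eq, wedgeEval_eq, Finset.smul_sum]
  symm
  refine Finset.sum_nbij' (fun σ => τ * σ * c (τ * σ)) (fun σ => τ⁻¹ * σ * c (τ⁻¹ * σ))
    ?_ ?_ ?_ ?_ ?_
  · intro σ _
    simpa using hcan _
  · intro σ _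
    simpa using hcan _
  · intro σ hσ
    exact inv τ σ (by simpa using hσ)
  · intro σ hσ
    simpa using inv τ⁻¹ σ (by simpa using hσ)
  · intro σ _
    rw [hterm, term_comp]

end Summand

section Linear

variable {K V : Type*} [Field K] [AddCommGroup V] [Module K V]

/-- The summand of `wedgeEval` as a multilinear map. -/
def termMap {n : ℕ} (α : V →ₗ[K] K) (ω : V →ₗ[K] V →ₗ[K] K) (σ : Perm (Fin (2*n+1))) :
    MultilinearMap K (fun _ : Fin (2*n+1) => V) K :=
  have update_eq : ∀ (v : Fin (2*n+1) → V) (k : Fin (2*n+1)), ∃ L : V →ₗ[K] K,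
      ∀ x [inst : DecidableEq (Fin (2*n+1))],
        term (fun x => α x) (fun x y => ω x y) (@Function.update _ _ inst v k x) σ = L x := by
    intro v k
    obtain ⟨p, rfl⟩ := σ.surjective k
    obtain rfl | ⟨i, c, rfl⟩ := eq_root_or_pos p
    · refine ⟨((Perm.sign σ : ℤ) : K) •
        (∏ i : Fin n, ω (v (σ (pos i false))) (v (σ (pos i true)))) • α, fun x _ => ?_⟩
      simp only [term, Function.update_self, ne_eq, EmbeddingLike.apply_eq_iff_eq, pos_ne_root,
        not_false_eq_true, Function.update_of_ne, zsmul_eq_mul, LinearMap.smul_apply, smul_eq_mul]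
      ring
    · refine ⟨((Perm.sign σ : ℤ) : K) • α (v (σ (root n))) •
        (∏ j ∈ univ.erase i, ω (v (σ (pos j false))) (v (σ (pos j true)))) •
          (if c then ω (v (σ (pos i false))) else ω.flip (v (σ (pos i true)))), fun x _ => ?_⟩
      have hp : ∀ j ∈ univ.erase i,
          ω (Function.update v (σ (pos i c)) x (σ (pos j false)))
            (Function.update v (σ (pos i c)) x (σ (pos j true))) =
          ω (v (σ (pos j false))) (v (σ (pos j true))) := by
        intro j hj
        simp [pos_inj, Finset.ne_of_mem_erase hj]
      rw [term, ← Finset.mul_prod_erase univ _ (Finset.mem_univ i), Finset.prod_congr rfl hp]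
      cases c <;>
        simp only [ne_eq, EmbeddingLike.apply_eq_iff_eq, pos_inj, (pos_ne_root i _).symm,
          Function.update_self, not_false_eq_true, Function.update_of_ne, reduceCtorEq, and_false,
          zsmul_eq_mul, LinearMap.smul_apply, LinearMap.flip_apply, smul_eq_mul, if_true,
          Bool.false_eq_true, if_false] <;>
        ring
  { toFun := fun v => term (fun x => α x) (fun x y => ω x y) v σ
    map_update_add' := by
      intro _ v k x y
      obtain ⟨L, hL⟩ := update_eq v k
      simp only [hL, map_add]
    map_update_smul' := by
      intro _ v k c x
      obtain ⟨L, hL⟩ := update_eq v k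
      simp only [hL, map_smul] }

open Classical in
/-- `wedgeEval` as an alternating map. -/
noncomputable def wedgeMap (h2 : (2 : K) ≠ 0) (n : ℕ) (α : V →ₗ[K] K)
    (ω : V →ₗ[K] V →ₗ[K] K) (halt : ∀ x, ω x x = 0) : V [⋀^Fin (2*n+1)]→ₗ[K] K :=
  { (∑ σ : Perm (Fin (2*n+1)) with Canonical σ, termMap α ω σ) with
    map_eq_zero_of_eq' := by
      intro v i j hij hne
      have h := wedgeEval_comp (fun x => α x) (fun x y => ω x y)
        (fun x y => by simpa using ((LinearMap.IsAlt.neg halt) y x).symm) v (swap i j)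
      have hv : v ∘ swap i j = v := by
        ext k
        rcases eq_or_ne k i with rfl | hki
        · simp [hij]
        rcases eq_or_ne k j with rfl | hkj
        · simp [hij]
        simp [swap_apply_of_ne_of_ne hki hkj]
      rw [hv, Perm.sign_swap hne] at h
      have h0 : (2 : K) * wedgeEval K n (fun x => α x) (fun x y => ω x y) v = 0 := by
        simp at h
        linear_combination h
      have h1 := (mul_eq_zero.mp h0).resolve_left h2
      rw [wedgeEval_eq] at h1
      simpa [_root_.sum_apply, termMap] using h1 }

lemma wedgeMap_apply (h2 : (2 : K) ≠ 0) (n : ℕ) (α : V →ₗ[K] K)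
    (ω : V →ₗ[K] V →ₗ[K] K) (halt : ∀ x, ω x x = 0) (v : Fin (2*n+1) → V) :
    wedgeMap h2 n α ω halt v = wedgeEval K n (fun x => α x) (fun x y => ω x y) v := by
  classical
  rw [wedgeEval_eq]
  change (∑ σ : Perm (Fin (2*n+1)) with Canonical σ, termMap α ω σ) v = _
  rw [_root_.sum_apply]
  rfl

lemma wedgeEval_eq_zero_of_degenerate {n : ℕ} (α : V →ₗ[K] K) (ω : V →ₗ[K] V →ₗ[K] K)
    (halt : ∀ x, ω x x = 0) (v : Fin (2*n+1) → V) (hv : ∀ j, j ≠ root n → α (v j) = 0)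
    (k : Fin (2*n+1)) (hk : α (v k) = 0) (hkω : ∀ j, α (v j) = 0 → ω (v k) (v j) = 0) :
    wedgeEval K n (fun x => α x) (fun x y => ω x y) v = 0 := by
  classical
  rw [wedgeEval_eq]
  refine Finset.sum_eq_zero fun σ _ => ?_
  refine smul_eq_zero_of_right _ ?_
  obtain ⟨p, rfl⟩ := σ.surjective k
  obtain rfl | ⟨i, c, rfl⟩ := eq_root_or_pos p
  · simp [hk]
  by_cases h0 : σ (root n) = root n
  · have hα : ∀ d, α (v (σ (pos i d))) = 0 := fun d =>
      hv _ fun h => pos_ne_root i d (σ.injective (h.trans h0.symm))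
    refine mul_eq_zero_of_right _ (Finset.prod_eq_zero (Finset.mem_univ i) ?_)
    cases c
    · exact hkω _ (hα _)
    · simpa [hkω _ (hα _)] using ((LinearMap.IsAlt.neg halt) (v (σ (pos i true)))
        (v (σ (pos i false)))).symm
  · simp [hv _ h0]

lemma wedgeEval_of_symplectic {n : ℕ} (α : V →ₗ[K] K) (ω : V →ₗ[K] V →ₗ[K] K)
    (v : Fin (2*n+1) → V) (hv : ∀ j, j ≠ root n → α (v j) = 0)
    (hne : ∀ i j b c, i ≠ j → ω (v (pos i b)) (v (pos j c)) = 0)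
    (hone : ∀ i, ω (v (pos i false)) (v (pos i true)) = 1) :
    wedgeEval K n (fun x => α x) (fun x y => ω x y) v = α (v (root n)) := by
  classical
  have hcan : Canonical (1 : Perm (Fin (2*n+1))) :=
    ⟨fun i => by simp [pos], fun i j hij => by simpa [pos] using hij⟩
  rw [wedgeEval_eq, Finset.sum_eq_single_of_mem 1 (by simpa using hcan)]
  · simp [term, hone]
  intro σ hσ hσ1
  by_contra hterm
  obtain ⟨hα, hω⟩ : α (v (σ (root n))) ≠ 0 ∧
      ∀ i, ω (v (σ (pos i false))) (v (σ (pos i true))) ≠ 0 := by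
    have hprod := fun h => hterm (smul_eq_zero_of_right _ h)
    exact ⟨left_ne_zero_of_mul hprod, fun i =>
      Finset.prod_ne_zero_iff.mp (right_ne_zero_of_mul hprod) i (Finset.mem_univ i)⟩
  have h0 : σ (root n) = root n := by
    by_contra h
    exact hα (hv _ h)
  have hpos : ∀ i c, ∃ j d, σ (pos i c) = pos j d := fun i c =>
    (eq_root_or_pos _).resolve_left fun h => pos_ne_root i c (σ.injective (h.trans h0.symm))
  have hpair : PairPreserving σ := by
    refine ⟨h0, fun i => ?_⟩
    obtain ⟨j, b, hj⟩ := hpos i false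
    obtain ⟨k, c, hk⟩ := hpos i true
    have hjk : j = k := by
      by_contra h
      exact hω i (by rw [hj, hk, hne _ _ _ _ h])
    subst hjk
    have hbc : b ≠ c := by
      rintro rfl
      simpa [pos_inj] using σ.injective (hj.trans hk.symm)
    refine ⟨j, b, fun d => ?_⟩
    cases d
    · simpa using hj
    · rw [hk, Bool.eq_not.mpr hbc.symm, Bool.xor_true]
  exact hσ1 (hpair.eq_one hcan (by simpa using hσ))

lemma exists_symplectic (k : ℕ) : ∀ {W : Type*} [AddCommGroup W] [Module K W]
    [FiniteDimensional K W] (ω : W →ₗ[K] W →ₗ[K] K), (∀ x, ω x x = 0) →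
    (∀ x, (∀ y, ω x y = 0) → x = 0) → 2 * k ≤ Module.finrank K W →
    ∃ s : Fin k → Bool → W, (∀ i j b c, i ≠ j → ω (s i b) (s j c) = 0) ∧
      ∀ i, ω (s i false) (s i true) = 1 := by
  induction k with
  | zero => exact fun _ _ _ _ => ⟨fun i => i.elim0, fun i => i.elim0, fun i => i.elim0⟩
  | succ k ih =>
    intro W _ _ _ ω halt hnd hdim
    have hneg : ∀ x y, ω x y = -ω y x := fun x y => by
      simpa using ((LinearMap.IsAlt.neg halt) y x).symm
    have : Nontrivial W := Module.nontrivial_of_finrank_pos (R := K) (by omega)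
    obtain ⟨x, hx⟩ := exists_ne (0 : W)
    obtain ⟨y, hxy⟩ : ∃ y, ω x y = 1 := by
      by_contra! h
      refine hx (hnd x fun y => ?_)
      by_contra hy
      exact h ((ω x y)⁻¹ • y) (by simp [hy])
    let U := LinearMap.ker ((ω x).prod (ω y))
    have hU : ∀ u : W, u ∈ U ↔ ω x u = 0 ∧ ω y u = 0 := fun u => by simp [U]
    have hUdim : 2 * k ≤ Module.finrank K U := by
      have h1 := LinearMap.finrank_range_add_finrank_ker ((ω x).prod (ω y))
      have h2 := Submodule.finrank_le (LinearMap.range ((ω x).prod (ω y)))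
      rw [Module.finrank_prod, Module.finrank_self] at h2
      change _ + Module.finrank K U = _ at h1
      omega
    obtain ⟨s, hs, hs1⟩ := ih (ω.compl₁₂ U.subtype U.subtype) (fun u => halt _) (by
      intro u hu
      refine Subtype.ext (hnd u fun w => ?_)
      have hw : w - ω x w • y + ω y w • x ∈ U := by
        rw [hU]
        simp [halt, hxy, hneg y x]
      have h1 := hu ⟨_, hw⟩
      have h2 := (hU u).mp u.2
      simpa [hneg u x, hneg u y, h2.1, h2.2] using h1) hUdim
    refine ⟨Fin.cons (fun b => if b then y else x) fun i b => (s i b : W), ?_, ?_⟩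
    · have hl : ∀ (b : Bool) (u : W), u ∈ U → ω (if b then y else x) u = 0 := by
        intro b u hu
        cases b
        · exact ((hU u).mp hu).1
        · exact ((hU u).mp hu).2
      intro i j b c hij
      cases i using Fin.cases with
      | zero =>
        cases j using Fin.cases with
        | zero => exact absurd rfl hij
        | succ j => exact hl _ _ (s j c).2
      | succ i =>
        cases j using Fin.cases with
        | zero =>
          rw [hneg, neg_eq_zero]
          exact hl _ _ (s i b).2
        | succ j => exact hs i j b c fun h => hij (congrArg _ h)
    · intro i
      cases i using Fin.cases with
      | zero => simpa using hxy
      | succ i => exact hs1 i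

lemma finrank_ker [FiniteDimensional K V] {n : ℕ} (hrank : Module.finrank K V = 2*n+1)
    {α : V →ₗ[K] K} (hα : α ≠ 0) : Module.finrank K (LinearMap.ker α) = 2*n := by
  have := Module.Dual.finrank_ker_add_one_of_ne_zero (f := α) hα
  omega

lemma exists_basis_mem [FiniteDimensional K V] {d : ℕ} (hd : Module.finrank K V = d) {x : V}
    (hx : x ≠ 0) : ∃ (b : Module.Basis (Fin d) K V) (i : Fin d), b i = x := by
  have hs : LinearIndepOn K id ({x} : Set V) := LinearIndepOn.singleton hx
  let b := Module.Basis.extend hs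
  have : Fintype (hs.extend (Set.subset_univ _)) := FiniteDimensional.fintypeBasisIndex b
  let e := Fintype.equivFinOfCardEq ((Module.finrank_eq_card_basis b).symm.trans hd)
  refine ⟨b.reindex e, e ⟨x, Module.Basis.subset_extend hs rfl⟩, ?_⟩
  simp [b]

lemma eq_zero_of_wedgeEval_ne_zero [FiniteDimensional K V] (h2 : (2 : K) ≠ 0) {n : ℕ}
    (hrank : Module.finrank K V = 2*n+1) (α : V →ₗ[K] K) (ω : V →ₗ[K] V →ₗ[K] K)
    (halt : ∀ x, ω x x = 0) {v : Fin (2*n+1) → V}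
    (hv : wedgeEval K n (fun x => α x) (fun x y => ω x y) v ≠ 0) {x : V} (hαx : α x = 0)
    (hωx : ∀ y, α y = 0 → ω x y = 0) : x = 0 := by
  by_contra hx
  have hα : α ≠ 0 := by
    rintro rfl
    exact hv (by simp [wedgeEval])
  obtain ⟨z, hz⟩ : ∃ z, α z ≠ 0 := by
    by_contra! h
    exact hα (LinearMap.ext h)
  obtain ⟨b, i, hbi⟩ := exists_basis_mem (finrank_ker hrank hα)
    (x := (⟨x, hαx⟩ : LinearMap.ker α)) (by simpa [Subtype.ext_iff] using hx)
  let B : Module.Basis (Fin (2*n+1)) K V := Module.Basis.mkFinCons z b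
    (fun c y hy h => by
      have := congrArg α h
      simpa [LinearMap.mem_ker.mp hy, hz] using this)
    (fun w => ⟨-(α w / α z), by simp [hz]⟩)
  have hB0 : ∀ j, j ≠ root n → α (B j) = 0 := by
    intro j hj
    obtain ⟨l, rfl⟩ := Fin.exists_succ_eq.mpr hj
    simp [B]
  have hBi : B i.succ = x := by simp [B, hbi]
  have hB := wedgeEval_eq_zero_of_degenerate α ω halt B hB0 i.succ (by rw [hBi, hαx])
    fun j hj => by rw [hBi, hωx _ hj]
  rw [← wedgeMap_apply h2 n α ω halt] at hB hv
  rw [(wedgeMap h2 n α ω halt).eq_smul_basis_det B, hB] at hv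
  simp at hv

lemma exists_wedgeEval_ne_zero [FiniteDimensional K V] {n : ℕ}
    (hrank : Module.finrank K V = 2*n+1) (α : V →ₗ[K] K) (hα : α ≠ 0)
    (ω : V →ₗ[K] V →ₗ[K] K) (halt : ∀ x, ω x x = 0)
    (hnd : ∀ x, α x = 0 → (∀ y, α y = 0 → ω x y = 0) → x = 0) :
    ∃ v : Fin (2*n+1) → V, wedgeEval K n (fun x => α x) (fun x y => ω x y) v ≠ 0 := by
  obtain ⟨z, hz⟩ : ∃ z, α z ≠ 0 := by
    by_contra! h
    exact hα (LinearMap.ext h)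
  obtain ⟨s, hs, hs1⟩ := exists_symplectic n
    (ω.compl₁₂ (LinearMap.ker α).subtype (LinearMap.ker α).subtype) (fun _ => halt _)
    (fun x hx => Subtype.ext (hnd x x.2 fun y hy => hx ⟨y, hy⟩)) (finrank_ker hrank hα).ge
  let v : Fin (2*n+1) → V := fun k => ((idx n).symm k).elim z fun p => (s p.1 p.2 : V)
  have hroot : v (root n) = z := by simp [v, ← idx_none]
  have hpos : ∀ i c, v (pos i c) = s i c := fun i c => by simp [v, ← idx_some]
  refine ⟨v, ?_⟩
  rw [wedgeEval_of_symplectic α ω v, hroot]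
  · exact hz
  · intro j hj
    obtain ⟨i, c, rfl⟩ := (eq_root_or_pos j).resolve_left hj
    rw [hpos]
    exact (s i c).2
  · intro i j b c hij
    rw [hpos, hpos]
    exact hs i j b c hij
  · intro i
    rw [hpos, hpos]
    exact hs1 i

end Linear

end WedgeEval

/-- Let `(J,·)` be a `(2n+1)`-dimensional JJ-algebra, `α` a linear form and
`ω` an alternating bilinear form.  On the direct sum JJ-algebra `J ⊕ Ke` (modelled as
`V × K`, product `(x,s)·(y,t) = (x·y, 0)`) consider `Ω = ω + α ∧ e*`, i.e.
`Ω((x,s),(y,t)) = ω(x,y) + α(x)t − α(y)s`.  Then `(J,α,ω)` is cosymplectic iff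
`(J ⊕ Ke, Ω)` is symplectic. -/
theorem stmt15 {K V : Type*} [Field K] [AddCommGroup V] [Module K V]
    [FiniteDimensional K V] (h2 : (2 : K) ≠ 0) (h3 : (3 : K) ≠ 0)
    (n : ℕ) (hrank : Module.finrank K V = 2*n+1)
    (m : V →ₗ[K] V →ₗ[K] V)
    (hcomm : ∀ x y, m x y = m y x)
    (hjac : ∀ x y z, m x (m y z) + m y (m z x) + m z (m x y) = 0)
    (α : V →ₗ[K] K) (ω : V →ₗ[K] V →ₗ[K] K)
    (halt : ∀ x, ω x x = 0)
    (mE : V × K → V × K → V × K)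
    (hmE : ∀ u v, mE u v = (m u.1 v.1, (0 : K)))
    (Ω : V × K → V × K → K)
    (hΩ : ∀ u v, Ω u v = ω u.1 v.1 + α u.1 * v.2 - α v.1 * u.2) :
    ((∀ x y, α (m x y) = 0) ∧
      (∀ x y z, ω (m x y) z + ω (m z x) y + ω (m y z) x = 0) ∧
      (∃ v, wedgeEval K n (fun x => α x) (fun x y => ω x y) v ≠ 0)) ↔
    ((∀ u, (∀ w, Ω u w = 0) → u = 0) ∧
      (∀ u v w, Ω (mE u v) w + Ω (mE w u) v + Ω (mE v w) u = 0)) := by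
  have key : (∃ v, wedgeEval K n (fun x => α x) (fun x y => ω x y) v ≠ 0) ↔
      ∀ u, (∀ w, Ω u w = 0) → u = 0 := by
    constructor
    · rintro ⟨v, hv⟩ ⟨x, s⟩ hu
      simp only [hΩ] at hu
      have hαx : α x = 0 := by simpa using hu (0, 1)
      have hωx : ∀ y, ω x y = α y * s := fun y => by
        simpa [sub_eq_zero] using hu (y, 0)
      have hx : x = 0 := WedgeEval.eq_zero_of_wedgeEval_ne_zero h2 hrank α ω halt hv hαx
        fun y hy => by rw [hωx, hy, zero_mul]
      subst hx
      suffices hs : s = 0 by rw [hs]; rfl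
      by_contra hs
      have hα : ∀ y, α y = 0 := fun y => by simpa [hs] using (hωx y).symm
      exact hv (by simp [wedgeEval, hα])
    · intro hnd
      have hα : α ≠ 0 := by
        rintro rfl
        have := hnd (0, 1) fun w => by simp [hΩ]
        simp at this
      refine WedgeEval.exists_wedgeEval_ne_zero hrank α hα ω halt fun x hαx hωx => ?_
      obtain ⟨z, hz⟩ : ∃ z, α z ≠ 0 := by
        by_contra! h
        exact hα (LinearMap.ext h)
      refine congrArg Prod.fst (hnd (x, ω x z / α z) fun w => ?_)
      have h0 := hωx (w.1 - (α w.1 / α z) • z) (by simp [hz])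
      simp only [map_sub, map_smul, smul_eq_mul] at h0
      simp only [hΩ, hαx]
      linear_combination h0
  rw [← key]
  constructor
  · rintro ⟨hα, hω, hv⟩
    refine ⟨hv, fun u v w => ?_⟩
    simp only [hΩ, hmE, hα]
    linear_combination hω u.1 v.1 w.1
  · rintro ⟨hv, hc⟩
    simp only [hΩ, hmE] at hc
    refine ⟨fun x y => ?_, fun x y z => ?_, hv⟩
    · simpa using hc (x, 0) (y, 0) (0, 1)
    · simpa using hc (x, 0) (y, 0) (z, 0)
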